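/- Let d ≥ 2, ν > 0 and let Σ₁ : U₁ → ℝ^d, …, Σ_d : U_d → ℝ^d be smooth immersions on compact sets U_j ⊆ ℝ^{d-1} whose unit normals satisfy |det(ν_{Σ₁}(x₁), …, ν_{Σ_d}(x_d))| ≥ ν for all x_j ∈ U_j, with images S_j = Σ_j(U_j). For R ≥ 1 let C_rest(R) be the smallest constant C such that ( ∫_{B(0,R)} ∏_j |E_j g_j|^{2/(d-1)} )^{(d-1)/2} ≤ C ∏_j ‖g_j‖_{L^2(U_j)} for all g_j ∈ L^2(U_j), and for a fixed sufficiently large constant c > 0 (depending on the Σ_j) let C̃_rest(R) be the smallest constant C such that ( ∫_{B(0,R)} ∏_j |f̂_j|^{2/(d-1)} )^{(d-1)/2} ≤ C R^{-d/2} ∏_j ‖f_j‖_{L^2(ℝ^d)} for all f_j ∈ L^2(ℝ^d) supported in A_j(R) = S_j + B(0, c/R). Then there is a constant C', independent of R, such that C_rest(R) ≤ C' · C̃_rest(R) for all R ≥ 1. -/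

import Mathlib

open MeasureTheory Metric Complex
open scoped InnerProductSpace ENNReal Pointwise

/-- The extension operator associated with a parametrised hypersurface
`Σ : U → ℝ^d`, `U ⊆ ℝ^{d-1}`:  `Eg(ξ) = ∫_U g(x) e^{i ξ·Σ(x)} dx`. -/
noncomputable def extOp {n : ℕ} (U : Set (EuclideanSpace ℝ (Fin n)))
    (S : EuclideanSpace ℝ (Fin n) → EuclideanSpace ℝ (Fin (n + 1)))
    (g : EuclideanSpace ℝ (Fin n) → ℂ) (ξ : EuclideanSpace ℝ (Fin (n + 1))) : ℂ :=
  ∫ x in U, Complex.exp (Complex.I * (⟪ξ, S x⟫_ℝ : ℂ)) * g x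

/-- The `d`-dimensional Fourier transform `f̂(ξ) = ∫ e^{-i x·ξ} f(x) dx`. -/
noncomputable def fhat {d : ℕ} (f : EuclideanSpace ℝ (Fin d) → ℂ)
    (ξ : EuclideanSpace ℝ (Fin d)) : ℂ :=
  ∫ x, Complex.exp (-(Complex.I * (⟪x, ξ⟫_ℝ : ℂ))) * f x

/-- `C_rest(R)`: the smallest constant `C` in the `d`-linear extension inequality
`(∫_{B(0,R)} ∏_j |E_j g_j|^{2/(d-1)})^{(d-1)/2} ≤ C ∏_j ‖g_j‖_{L²(U_j)}`. -/
noncomputable def RestConst (n : ℕ)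
    (U : Fin (n + 1) → Set (EuclideanSpace ℝ (Fin n)))
    (S : Fin (n + 1) → EuclideanSpace ℝ (Fin n) → EuclideanSpace ℝ (Fin (n + 1)))
    (R : ℝ) : ℝ :=
  sInf {C : ℝ | 0 ≤ C ∧ ∀ g : (j : Fin (n + 1)) → EuclideanSpace ℝ (Fin n) → ℂ,
    (∫⁻ ξ in Metric.ball (0 : EuclideanSpace ℝ (Fin (n + 1))) R,
        ∏ j, (‖extOp (U j) (S j) (g j) ξ‖₊ : ℝ≥0∞) ^ ((2 : ℝ) / n)) ^ ((n : ℝ) / 2)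
      ≤ ENNReal.ofReal C * ∏ j, eLpNorm (g j) 2 (volume.restrict (U j))}

/-- `C̃_rest(R)`: the smallest constant `C` in the inequality
`(∫_{B(0,R)} ∏_j |f̂_j|^{2/(d-1)})^{(d-1)/2} ≤ C R^{-d/2} ∏_j ‖f_j‖_{L²(ℝ^d)}` over all
`f_j` supported in the neighbourhood `A_j(R) = S_j + B(0, c/R)` of the surface
`S_j = Σ_j(U_j)`. -/
noncomputable def TildeRestConst (n : ℕ)
    (U : Fin (n + 1) → Set (EuclideanSpace ℝ (Fin n)))
    (S : Fin (n + 1) → EuclideanSpace ℝ (Fin n) → EuclideanSpace ℝ (Fin (n + 1)))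
    (c R : ℝ) : ℝ :=
  sInf {C : ℝ | 0 ≤ C ∧ ∀ f : (j : Fin (n + 1)) → EuclideanSpace ℝ (Fin (n + 1)) → ℂ,
    (∀ j, Function.support (f j) ⊆ (S j '' U j) + Metric.ball 0 (c / R)) →
    (∫⁻ ξ in Metric.ball (0 : EuclideanSpace ℝ (Fin (n + 1))) R,
        ∏ j, (‖fhat (f j) ξ‖₊ : ℝ≥0∞) ^ ((2 : ℝ) / n)) ^ ((n : ℝ) / 2)
      ≤ ENNReal.ofReal (C * R ^ (-((n : ℝ) + 1) / 2)) *
        ∏ j, eLpNorm (f j) 2 volume}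

/-- Near a point where its derivative is injective, a smooth map expands distances by at least a
fixed factor. -/
lemma exists_nhds_norm_sub_le {E F : Type*} [NormedAddCommGroup E] [NormedSpace ℝ E]
    [FiniteDimensional ℝ E] [NormedAddCommGroup F] [NormedSpace ℝ F] {S : E → F} {L : E →L[ℝ] F}
    {x₀ : E} (hS : HasStrictFDerivAt S L x₀) (hL : Function.Injective L) :
    ∃ K : ℝ, 0 < K ∧ ∃ V ∈ nhds x₀, ∀ x ∈ V, ∀ y ∈ V, ‖x - y‖ ≤ K * ‖S x - S y‖ := by
  obtain ⟨K, hK0, hK⟩ := LinearMap.exists_antilipschitzWith (L : E →ₗ[ℝ] F)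
    (LinearMap.ker_eq_bot.2 hL)
  have hK0' : (0 : ℝ) < K := hK0
  have hlow : ∀ v, ‖v‖ ≤ K * ‖L v‖ := fun v => by
    simpa [dist_eq_norm] using hK.le_mul_dist v 0
  have hev := hS.isLittleO.def (c := 1 / (2 * (K : ℝ))) (by positivity)
  rw [nhds_prod_eq] at hev
  obtain ⟨V, hV, hVS⟩ := Filter.eventually_prod_self_iff
    (r := fun x y => ‖S x - S y - L (x - y)‖ ≤ 1 / (2 * (K : ℝ)) * ‖x - y‖) |>.1 hev
  refine ⟨2 * K, by positivity, V, hV, fun x hx y hy => ?_⟩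
  have h1 := hVS x hx y hy
  have h2 := hlow (x - y)
  have h3 : ‖L (x - y)‖ ≤ ‖S x - S y‖ + ‖S x - S y - L (x - y)‖ := by
    have := norm_sub_le (S x - S y) (S x - S y - L (x - y))
    simpa using this
  have h4 : (K : ℝ) * ‖S x - S y - L (x - y)‖ ≤ ‖x - y‖ / 2 := by
    calc (K : ℝ) * ‖S x - S y - L (x - y)‖ ≤ K * (1 / (2 * K) * ‖x - y‖) := by gcongr
      _ = ‖x - y‖ / 2 := by field_simp
  nlinarith [mul_le_mul_of_nonneg_left h3 hK0'.le]

/-- The part of a compact set which a smooth immersion maps into a ball of radius `ρ` has measure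
`O(ρ ^ n)`. -/
lemma exists_volume_preimage_ball_le {n : ℕ} {F : Type*} [NormedAddCommGroup F] [NormedSpace ℝ F]
    {U : Set (EuclideanSpace ℝ (Fin n))} (hU : IsCompact U) {S : EuclideanSpace ℝ (Fin n) → F}
    (hS : ∀ x ∈ U, HasStrictFDerivAt S (fderiv ℝ S x) x)
    (hSimm : ∀ x ∈ U, Function.Injective (fderiv ℝ S x)) :
    ∃ K : NNReal, ∀ (y : F) (ρ : ℝ), 0 < ρ →
      volume (U ∩ {x | y - S x ∈ ball 0 ρ}) ≤ K * ENNReal.ofReal (ρ ^ n) := by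
  refine hU.induction_on (p := fun s => ∃ K : NNReal, ∀ (y : F) (ρ : ℝ), 0 < ρ →
      volume (s ∩ {x | y - S x ∈ ball 0 ρ}) ≤ K * ENNReal.ofReal (ρ ^ n)) ?_ ?_ ?_ ?_
  · exact ⟨0, by simp⟩
  · rintro s t hst ⟨K, hK⟩
    exact ⟨K, fun y ρ hρ =>
      (measure_mono (Set.inter_subset_inter_left _ hst)).trans (hK y ρ hρ)⟩
  · rintro s t ⟨K, hK⟩ ⟨K', hK'⟩
    refine ⟨K + K', fun y ρ hρ => ?_⟩
    rw [Set.union_inter_distrib_right, ENNReal.coe_add, add_mul]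
    exact (measure_union_le _ _).trans (add_le_add (hK y ρ hρ) (hK' y ρ hρ))
  · intro x₀ hx₀
    obtain ⟨m, hm, V, hV, hVS⟩ := exists_nhds_norm_sub_le (hS x₀ hx₀) (hSimm x₀ hx₀)
    refine ⟨V, mem_nhdsWithin_of_mem_nhds hV,
      ((2 * m) ^ n).toNNReal * (volume (ball (0 : EuclideanSpace ℝ (Fin n)) 1)).toNNReal,
      fun y ρ hρ => ?_⟩
    rcases (V ∩ {x | y - S x ∈ ball 0 ρ}).eq_empty_or_nonempty with h | ⟨z, hzV, hz⟩
    · rw [h, measure_empty]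
      exact zero_le
    have hsub : V ∩ {x | y - S x ∈ ball 0 ρ} ⊆ closedBall z (2 * m * ρ) := by
      rintro x ⟨hxV, hx⟩
      simp only [Set.mem_ofPred_eq, mem_ball_zero_iff] at hx hz
      rw [mem_closedBall, dist_eq_norm]
      have h1 : ‖S x - S z‖ ≤ 2 * ρ := by
        have := norm_sub_le (y - S z) (y - S x)
        rw [sub_sub_sub_cancel_left] at this
        linarith
      calc ‖x - z‖ ≤ m * ‖S x - S z‖ := hVS x hxV z hzV
        _ ≤ m * (2 * ρ) := by gcongr
        _ = 2 * m * ρ := by ring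
    refine (measure_mono hsub).trans (le_of_eq ?_)
    rw [Measure.addHaar_closedBall _ _ (by positivity), finrank_euclideanSpace_fin, mul_pow,
      ENNReal.ofReal_mul (by positivity), ENNReal.coe_mul,
      ENNReal.coe_toNNReal measure_ball_lt_top.ne, ENNReal.ofReal]
    ring

/-- The Fourier transform turns the superposition of translates `∫_U φ(y - Σ(x)) g(x) dx` into a
product. -/
lemma fhat_integral_translate {n d : ℕ} {U : Set (EuclideanSpace ℝ (Fin n))}
    {S : EuclideanSpace ℝ (Fin n) → EuclideanSpace ℝ (Fin d)} (hS : Continuous S)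
    {g : EuclideanSpace ℝ (Fin n) → ℂ} (hg : IntegrableOn g U)
    {φ : EuclideanSpace ℝ (Fin d) → ℂ} (hφm : Measurable φ) (hφ : Integrable φ)
    (ξ : EuclideanSpace ℝ (Fin d)) :
    fhat (fun y => ∫ x in U, φ (y - S x) * g x) ξ =
      fhat φ ξ * ∫ x in U, Complex.exp (-(Complex.I * (⟪S x, ξ⟫_ℝ : ℂ))) * g x := by
  have hnorm : ∀ y : EuclideanSpace ℝ (Fin d),
      ‖Complex.exp (-(Complex.I * (⟪y, ξ⟫_ℝ : ℂ)))‖ = 1 := fun y => by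
    simp [Complex.norm_exp]
  have hmeas : AEStronglyMeasurable
      (Function.uncurry fun (y : EuclideanSpace ℝ (Fin d)) (x : EuclideanSpace ℝ (Fin n)) =>
        Complex.exp (-(Complex.I * (⟪y, ξ⟫_ℝ : ℂ))) * (φ (y - S x) * g x))
      (volume.prod (volume.restrict U)) := by
    refine AEStronglyMeasurable.mul ?_ (AEStronglyMeasurable.mul ?_ ?_)
    · exact Continuous.aestronglyMeasurable (by fun_prop)
    · exact (hφm.comp (by fun_prop : Measurable fun p : EuclideanSpace ℝ (Fin d) ×
        EuclideanSpace ℝ (Fin n) => p.1 - S p.2)).aestronglyMeasurable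
    · exact hg.aestronglyMeasurable.comp_snd
  have hint : Integrable
      (Function.uncurry fun (y : EuclideanSpace ℝ (Fin d)) (x : EuclideanSpace ℝ (Fin n)) =>
        Complex.exp (-(Complex.I * (⟪y, ξ⟫_ℝ : ℂ))) * (φ (y - S x) * g x))
      (volume.prod (volume.restrict U)) := by
    rw [integrable_prod_iff' hmeas]
    simp only [Function.uncurry_apply_pair, norm_mul, hnorm, one_mul]
    constructor
    · refine Filter.Eventually.of_forall fun x => ?_
      refine Integrable.bdd_mul (c := 1) ((hφ.comp_sub_right (S x)).mul_const _)
        (Continuous.aestronglyMeasurable (by fun_prop)) (by simp [hnorm])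
    · simp_rw [integral_mul_const, integral_sub_right_eq_self (fun y => ‖φ y‖)]
      exact hg.norm.const_mul _
  simp only [fhat]
  calc _ = ∫ y, ∫ x in U, Complex.exp (-(Complex.I * (⟪y, ξ⟫_ℝ : ℂ))) * (φ (y - S x) * g x) := by
        simp_rw [integral_const_mul]
    _ = ∫ x in U, ∫ y, Complex.exp (-(Complex.I * (⟪y, ξ⟫_ℝ : ℂ))) * (φ (y - S x) * g x) :=
        integral_integral_swap hint
    _ = _ := by
        rw [← integral_const_mul]
        congr 1
        ext x
        rw [← integral_sub_right_eq_self (μ := volume) _ (-(S x)), ← integral_mul_const]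
        congr 1
        ext y
        rw [sub_neg_eq_add, add_sub_cancel_right, inner_add_left]
        push_cast
        rw [mul_add, neg_add, Complex.exp_add]
        ring

/-- A nonmeasurable function has zero Fourier transform by convention, so the Cauchy–Schwarz bound
holds for every function vanishing outside `A`. -/
lemma enorm_fhat_le {d : ℕ} {A : Set (EuclideanSpace ℝ (Fin d))} (hA : MeasurableSet A)
    {f : EuclideanSpace ℝ (Fin d) → ℂ} (hf : Function.support f ⊆ A)
    (ξ : EuclideanSpace ℝ (Fin d)) :
    ‖fhat f ξ‖ₑ ≤ volume A ^ (1 / 2 : ℝ) * eLpNorm f 2 volume := by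
  by_cases hfm : AEStronglyMeasurable f
  · have h1 : ‖fhat f ξ‖ₑ ≤ eLpNorm f 1 volume := by
      rw [eLpNorm_one_eq_lintegral_enorm]
      refine (enorm_integral_le_lintegral_enorm _).trans (le_of_eq ?_)
      congr 1
      ext x
      rw [enorm_mul, ← ofReal_norm (Complex.exp _), Complex.norm_exp]
      simp
    have h2 : eLpNorm f 1 volume = eLpNorm f 1 (volume.restrict A) := by
      rw [← eLpNorm_indicator_eq_eLpNorm_restrict hA, Set.indicator_eq_self.2 hf]
    have h3 := eLpNorm_le_eLpNorm_mul_rpow_measure_univ (p := 1) (q := 2) (by norm_num)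
      (hfm.restrict (s := A))
    refine (h1.trans_eq h2).trans (h3.trans ?_)
    rw [mul_comm, Measure.restrict_apply_univ]
    norm_num
    gcongr
    exact Measure.restrict_le_self
  · have : fhat f ξ = 0 := by
      refine integral_undef fun h => hfm ?_
      have := (Continuous.aestronglyMeasurable (μ := volume) (by fun_prop :
        Continuous fun x : EuclideanSpace ℝ (Fin d) =>
          Complex.exp (Complex.I * (⟪x, ξ⟫_ℝ : ℂ)))).mul h.aestronglyMeasurable
      refine this.congr (Filter.Eventually.of_forall fun x => ?_)
      simp [← mul_assoc, ← Complex.exp_add]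
    simp [this]

/-- If every translate of `-B` pulls back under `S` to a set of measure at most `M`, then averaging
over these sets is bounded on `L²`. -/
lemma eLpNorm_integral_indicator_translate_le {n d : ℕ} {U : Set (EuclideanSpace ℝ (Fin n))}
    {S : EuclideanSpace ℝ (Fin n) → EuclideanSpace ℝ (Fin d)} (hS : Continuous S)
    {g : EuclideanSpace ℝ (Fin n) → ℂ} (hg : AEStronglyMeasurable g (volume.restrict U))
    {B : Set (EuclideanSpace ℝ (Fin d))} (hB : MeasurableSet B) {M : ℝ≥0∞}
    (hM : ∀ y, volume (U ∩ {x | y - S x ∈ B}) ≤ M) :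
    eLpNorm (fun y => ∫ x in U, B.indicator (1 : EuclideanSpace ℝ (Fin d) → ℂ) (y - S x) * g x)
        2 volume ≤ (M * volume B) ^ (1 / 2 : ℝ) * eLpNorm g 2 (volume.restrict U) := by
  have hE : ∀ y, MeasurableSet {x | y - S x ∈ B} := fun y =>
    (by fun_prop : Measurable fun x => y - S x) hB
  have hpt : ∀ y, ‖∫ x in U, B.indicator (1 : EuclideanSpace ℝ (Fin d) → ℂ) (y - S x) * g x‖ₑ
      ^ (2 : ℝ) ≤ M * ∫⁻ x in U, B.indicator 1 (y - S x) * ‖g x‖ₑ ^ (2 : ℝ) := by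
    intro y
    set μ := (volume.restrict U).restrict {x | y - S x ∈ B} with hμ
    have h0 : ∫ x in U, B.indicator (1 : EuclideanSpace ℝ (Fin d) → ℂ) (y - S x) * g x
        = ∫ x, g x ∂μ := by
      rw [hμ, ← integral_indicator (hE y)]
      congr 1
      ext x
      by_cases hx : y - S x ∈ B <;> simp [Set.indicator, hx]
    have h0' : ∫⁻ x in U, B.indicator 1 (y - S x) * ‖g x‖ₑ ^ (2 : ℝ)
        = ∫⁻ x, ‖g x‖ₑ ^ (2 : ℝ) ∂μ := by
      rw [hμ, ← lintegral_indicator (hE y)]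
      congr 1
      ext x
      by_cases hx : y - S x ∈ B <;> simp [Set.indicator, hx]
    have hμM : μ Set.univ ≤ M := by
      rw [hμ, Measure.restrict_apply_univ, Measure.restrict_apply (hE y), Set.inter_comm]
      exact hM y
    have h1 : ‖∫ x, g x ∂μ‖ₑ ≤ (∫⁻ x, ‖g x‖ₑ ^ (2 : ℝ) ∂μ) ^ (1 / 2 : ℝ) * M ^ (1 / 2 : ℝ) := by
      refine (enorm_integral_le_lintegral_enorm _).trans ?_
      rw [← eLpNorm_one_eq_lintegral_enorm]
      refine (eLpNorm_le_eLpNorm_mul_rpow_measure_univ (p := 1) (q := 2) (by norm_num)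
        (hg.mono_measure Measure.restrict_le_self)).trans ?_
      rw [eLpNorm_eq_lintegral_rpow_enorm_toReal (by norm_num) (by norm_num)]
      norm_num only [ENNReal.toReal_ofNat, ENNReal.toReal_one]
      gcongr
    rw [h0, h0']
    calc _ ≤ ((∫⁻ x, ‖g x‖ₑ ^ (2 : ℝ) ∂μ) ^ (1 / 2 : ℝ) * M ^ (1 / 2 : ℝ)) ^ (2 : ℝ) := by gcongr
      _ = _ := by
        rw [ENNReal.mul_rpow_of_nonneg _ _ (by norm_num), ← ENNReal.rpow_mul, ← ENNReal.rpow_mul]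
        norm_num
        rw [mul_comm]
  have hgm : AEMeasurable (fun x => ‖g x‖ₑ ^ (2 : ℝ)) (volume.restrict U) := hg.enorm.pow_const _
  have hind : Measurable (B.indicator (1 : EuclideanSpace ℝ (Fin d) → ℝ≥0∞)) :=
    measurable_one.indicator hB
  have hmeas : AEMeasurable (Function.uncurry fun (y : EuclideanSpace ℝ (Fin d)) x =>
      B.indicator (1 : EuclideanSpace ℝ (Fin d) → ℝ≥0∞) (y - S x) * ‖g x‖ₑ ^ (2 : ℝ))
      (volume.prod (volume.restrict U)) := by
    refine AEMeasurable.mul ?_ ?_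
    · exact (hind.comp (by fun_prop : Measurable fun p : EuclideanSpace ℝ (Fin d) ×
        EuclideanSpace ℝ (Fin n) => p.1 - S p.2)).aemeasurable
    · exact hgm.comp_snd
  have htot : ∫⁻ y, ‖∫ x in U, B.indicator (1 : EuclideanSpace ℝ (Fin d) → ℂ) (y - S x) * g x‖ₑ
      ^ (2 : ℝ) ≤ M * volume B * ∫⁻ x in U, ‖g x‖ₑ ^ (2 : ℝ) := by
    calc _ ≤ ∫⁻ y, M * ∫⁻ x in U, B.indicator 1 (y - S x) * ‖g x‖ₑ ^ (2 : ℝ) :=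
          lintegral_mono hpt
      _ = M * ∫⁻ y, ∫⁻ x in U, B.indicator 1 (y - S x) * ‖g x‖ₑ ^ (2 : ℝ) :=
          lintegral_const_mul'' _ hmeas.lintegral_prod_right'
      _ = M * ∫⁻ x in U, ∫⁻ y, B.indicator 1 (y - S x) * ‖g x‖ₑ ^ (2 : ℝ) := by
          rw [lintegral_lintegral_swap hmeas]
      _ = M * ∫⁻ x in U, volume B * ‖g x‖ₑ ^ (2 : ℝ) := by
          congr 2
          ext x
          rw [lintegral_mul_const (f := fun y => B.indicator 1 (y - S x)) _
              (hind.comp (by fun_prop : Measurable fun y => y - S x)),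
            lintegral_sub_right_eq_self (B.indicator (1 : EuclideanSpace ℝ (Fin d) → ℝ≥0∞)),
            lintegral_indicator_one hB]
      _ = _ := by rw [lintegral_const_mul'' _ hgm, mul_assoc]
  rw [eLpNorm_eq_lintegral_rpow_enorm_toReal (by norm_num) (by norm_num),
    eLpNorm_eq_lintegral_rpow_enorm_toReal (by norm_num) (by norm_num)]
  simp only [ENNReal.toReal_ofNat]
  rw [← ENNReal.mul_rpow_of_nonneg _ _ (by norm_num)]
  gcongr

/-- The Fourier transform of the indicator of a ball of radius `1 / R` is comparable to its integral
on the dual ball of radius `R`. -/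
lemma volume_ball_le_norm_fhat_indicator {d : ℕ} {R : ℝ} (hR : 0 < R)
    {ξ : EuclideanSpace ℝ (Fin d)} (hξ : ξ ∈ ball 0 R) :
    volume.real (ball (0 : EuclideanSpace ℝ (Fin d)) (1 / R)) / 2 ≤
      ‖fhat ((ball 0 (1 / R)).indicator (1 : EuclideanSpace ℝ (Fin d) → ℂ)) ξ‖ := by
  have h0 : fhat ((ball 0 (1 / R)).indicator (1 : EuclideanSpace ℝ (Fin d) → ℂ)) ξ =
      ∫ y in ball 0 (1 / R), Complex.exp (-(Complex.I * (⟪y, ξ⟫_ℝ : ℂ))) := by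
    rw [fhat, ← integral_indicator measurableSet_ball]
    congr 1
    ext y
    by_cases hy : y ∈ ball 0 (1 / R) <;> simp only [Set.indicator, hy] <;> simp
  have hint : IntegrableOn (fun y : EuclideanSpace ℝ (Fin d) =>
      Complex.exp (-(Complex.I * (⟪y, ξ⟫_ℝ : ℂ)))) (ball 0 (1 / R)) :=
    ((Continuous.continuousOn (by fun_prop)).integrableOn_compact
      (isCompact_closedBall _ _)).mono_set ball_subset_closedBall
  rw [h0]
  refine le_trans ?_ (Complex.re_le_norm _)
  have hre : (∫ y in ball 0 (1 / R), Complex.exp (-(Complex.I * (⟪y, ξ⟫_ℝ : ℂ)))).re =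
      ∫ y in ball 0 (1 / R), (Complex.exp (-(Complex.I * (⟪y, ξ⟫_ℝ : ℂ)))).re :=
    (integral_re hint).symm
  rw [hre]
  calc _ = ∫ y in ball (0 : EuclideanSpace ℝ (Fin d)) (1 / R), (1 / 2 : ℝ) := by
        rw [setIntegral_const, smul_eq_mul]; ring
    _ ≤ _ := by
        refine setIntegral_mono_on ?_ hint.re measurableSet_ball fun y hy => ?_
        · exact integrableOn_const measure_ball_lt_top.ne
        · have h1 : |⟪y, ξ⟫_ℝ| ≤ 1 := by
            refine (abs_real_inner_le_norm y ξ).trans ?_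
            rw [mem_ball_zero_iff] at hy hξ
            calc ‖y‖ * ‖ξ‖ ≤ 1 / R * R := by gcongr
              _ = 1 := by field_simp
          have h2 : (Complex.exp (-(Complex.I * (⟪y, ξ⟫_ℝ : ℂ)))).re = Real.cos ⟪y, ξ⟫_ℝ := by
            rw [Complex.exp_re]
            simp
          rw [h2]
          have h3 := Real.one_sub_sq_div_two_le_cos (x := ⟪y, ξ⟫_ℝ)
          have h4 := (sq_le_one_iff_abs_le_one _).2 h1
          linarith

/-- On the ball of radius `R`, an extension `Eg` is dominated by the Fourier transform of a function
carried by the `1 / R`-neighbourhood of the surface, with `L²` norm `O(R ^ (1 / 2)) ‖g‖₂`. -/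
lemma exists_enorm_extOp_le_enorm_fhat {n : ℕ} {U : Set (EuclideanSpace ℝ (Fin n))}
    (hU : IsCompact U) {S : EuclideanSpace ℝ (Fin n) → EuclideanSpace ℝ (Fin (n + 1))}
    (hS : ContDiff ℝ (⊤ : ℕ∞) S) (hSimm : ∀ x ∈ U, Function.Injective (fderiv ℝ S x)) :
    ∃ K : ℝ, 0 ≤ K ∧ ∀ R : ℝ, 1 ≤ R → ∀ g : EuclideanSpace ℝ (Fin n) → ℂ,
      ∃ f : EuclideanSpace ℝ (Fin (n + 1)) → ℂ,
        Function.support f ⊆ (S '' U) + ball 0 (1 / R) ∧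
        (∀ ξ ∈ ball 0 R, ‖extOp U S g ξ‖ₑ ≤ ‖fhat f ξ‖ₑ) ∧
        eLpNorm f 2 volume ≤
          ENNReal.ofReal (K * R ^ (1 / 2 : ℝ)) * eLpNorm g 2 (volume.restrict U) := by
  obtain ⟨K, hK⟩ := exists_volume_preimage_ball_le hU
    (fun x _ => hS.contDiffAt.hasStrictFDerivAt (by simp)) hSimm
  set b := volume.real (ball (0 : EuclideanSpace ℝ (Fin (n + 1))) 1) with hb
  have hb0 : 0 < b := ENNReal.toReal_pos (measure_ball_pos _ _ one_pos).ne' measure_ball_lt_top.ne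
  refine ⟨(4 * K / b) ^ (1 / 2 : ℝ), by positivity, fun R hR g => ?_⟩
  have hR0 : 0 < R := one_pos.trans_le hR
  by_cases hg : IntegrableOn g U
  swap
  · refine ⟨0, by simp, fun ξ _ => ?_, by simp⟩
    have : extOp U S g ξ = 0 := by
      refine integral_undef fun h => hg ?_
      have hSc := hS.continuous
      refine (h.bdd_mul (c := 1) (f := fun x => Complex.exp (-(Complex.I * (⟪ξ, S x⟫_ℝ : ℂ))))
        (Continuous.aestronglyMeasurable (by fun_prop)) (by simp [Complex.norm_exp])).congr
        (Filter.Eventually.of_forall fun x => ?_)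
      simp [← mul_assoc, ← Complex.exp_add]
    simp [this]
  set v := volume.real (ball (0 : EuclideanSpace ℝ (Fin (n + 1))) (1 / R)) with hv
  have hv0 : 0 < v := ENNReal.toReal_pos (measure_ball_pos _ _ (by positivity)).ne'
    measure_ball_lt_top.ne
  have hvb : v = (1 / R) ^ (n + 1) * b := by
    rw [hv, hb, measureReal_def, Measure.addHaar_ball _ _ (by positivity),
      finrank_euclideanSpace_fin, ENNReal.toReal_mul, ENNReal.toReal_ofReal (by positivity),
      measureReal_def]
  set φ := (ball 0 (1 / R)).indicator (1 : EuclideanSpace ℝ (Fin (n + 1)) → ℂ) with hφ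
  have hφm : Measurable φ := measurable_one.indicator measurableSet_ball
  have hφi : Integrable φ :=
    (integrable_indicator_iff measurableSet_ball).2 (integrableOn_const measure_ball_lt_top.ne)
  have hgc : IntegrableOn (fun x => (starRingEnd ℂ) (g x)) U := by
    refine hg.norm.mono' ?_ (by simp)
    exact Complex.continuous_conj.comp_aestronglyMeasurable hg.aestronglyMeasurable
  set h : EuclideanSpace ℝ (Fin (n + 1)) → ℂ :=
    fun y => ∫ x in U, φ (y - S x) * (starRingEnd ℂ) (g x) with hh
  refine ⟨fun y => ((2 / v : ℝ) : ℂ) * h y, ?_, fun ξ hξ => ?_, ?_⟩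
  · intro y hy
    by_contra hy'
    refine hy ?_
    have : h y = 0 := by
      refine setIntegral_eq_zero_of_forall_eq_zero fun x hx => ?_
      have : y - S x ∉ ball 0 (1 / R) := fun hb =>
        hy' ⟨S x, ⟨x, hx, rfl⟩, y - S x, hb, add_sub_cancel _ _⟩
      rw [hφ, Set.indicator_of_notMem this, zero_mul]
    simp [this]
  · have h1 : fhat (fun y => ((2 / v : ℝ) : ℂ) * h y) ξ = ((2 / v : ℝ) : ℂ) *
        (fhat φ ξ * (starRingEnd ℂ) (extOp U S g ξ)) := by
      have h2 : (starRingEnd ℂ) (extOp U S g ξ) = ∫ x in U,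
          Complex.exp (-(Complex.I * (⟪S x, ξ⟫_ℝ : ℂ))) * (starRingEnd ℂ) (g x) := by
        rw [extOp, ← integral_conj]
        congr 1
        ext x
        rw [map_mul, ← Complex.exp_conj, real_inner_comm]
        simp
      rw [h2, ← fhat_integral_translate hS.continuous hgc hφm hφi, fhat, fhat,
        ← integral_const_mul]
      congr 1
      ext y
      ring
    rw [h1, ← ofReal_norm, ← ofReal_norm]
    refine ENNReal.ofReal_le_ofReal ?_
    rw [norm_mul, norm_mul, RCLike.norm_conj, Complex.norm_real, Real.norm_of_nonneg (by positivity),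
      ← mul_assoc]
    refine le_mul_of_one_le_left (norm_nonneg _) ?_
    calc 1 = 2 / v * (v / 2) := by field_simp
      _ ≤ _ := by
        gcongr
        exact volume_ball_le_norm_fhat_indicator hR0 hξ
  · have h1 := eLpNorm_integral_indicator_translate_le hS.continuous hgc.aestronglyMeasurable
      measurableSet_ball (fun y => hK y (1 / R) (by positivity))
    have h2 : eLpNorm (fun x => (starRingEnd ℂ) (g x)) 2 (volume.restrict U) =
        eLpNorm g 2 (volume.restrict U) := eLpNorm_congr_norm_ae (by simp)
    rw [h2] at h1
    have h3 : ENNReal.ofReal ((4 * K / b) ^ (1 / 2 : ℝ) * R ^ (1 / 2 : ℝ)) =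
        ENNReal.ofReal (2 / v) * (K * ENNReal.ofReal ((1 / R) ^ n) *
          volume (ball (0 : EuclideanSpace ℝ (Fin (n + 1))) (1 / R))) ^ (1 / 2 : ℝ) := by
      rw [← ofReal_measureReal measure_ball_lt_top.ne, ← hv, ← ENNReal.ofReal_coe_nnreal,
        ← ENNReal.ofReal_mul (by positivity), ← ENNReal.ofReal_mul (by positivity),
        ENNReal.ofReal_rpow_of_nonneg (by positivity) (by norm_num),
        ← ENNReal.ofReal_mul (by positivity), ← Real.sqrt_eq_rpow, ← Real.sqrt_eq_rpow,
        ← Real.sqrt_eq_rpow, ← Real.sqrt_mul (by positivity)]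
      congr 1
      have hv2 : 2 / v = √((2 / v) ^ 2) := (Real.sqrt_sq (by positivity)).symm
      rw [hv2, ← Real.sqrt_mul (by positivity), hvb]
      congr 1
      rw [one_div, inv_pow, inv_pow]
      field_simp
      ring
    rw [h3, mul_assoc]
    refine (eLpNorm_const_smul_le (c := ((2 / v : ℝ) : ℂ)) (f := h)).trans ?_
    rw [← ofReal_norm, Complex.norm_real, Real.norm_of_nonneg (by positivity)]
    gcongr

/-- The estimates defining `C̃_rest(R)` hold with some finite constant. -/
lemma exists_multilinear_fhat_bound {n : ℕ} (A : Fin (n + 1) → Set (EuclideanSpace ℝ (Fin (n + 1))))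
    (hA : ∀ j, MeasurableSet (A j)) (hAfin : ∀ j, volume (A j) ≠ ⊤) (hn : 1 ≤ n) (R : ℝ) :
    ∃ C : ℝ, 0 ≤ C ∧ ∀ f : (j : Fin (n + 1)) → EuclideanSpace ℝ (Fin (n + 1)) → ℂ,
      (∀ j, Function.support (f j) ⊆ A j) →
      (∫⁻ ξ in Metric.ball (0 : EuclideanSpace ℝ (Fin (n + 1))) R,
          ∏ j, (‖fhat (f j) ξ‖₊ : ℝ≥0∞) ^ ((2 : ℝ) / n)) ^ ((n : ℝ) / 2)
        ≤ ENNReal.ofReal C * ∏ j, eLpNorm (f j) 2 volume := by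
  have hn0 : (0 : ℝ) < n := by exact_mod_cast hn
  set V := volume (ball (0 : EuclideanSpace ℝ (Fin (n + 1))) R) with hV
  set M := V ^ ((n : ℝ) / 2) * ∏ j, volume (A j) ^ (1 / 2 : ℝ) with hM
  have hMfin : M ≠ ⊤ := by
    refine ENNReal.mul_ne_top (ENNReal.rpow_ne_top_of_nonneg (by positivity)
      measure_ball_lt_top.ne) (ENNReal.prod_ne_top fun j _ => ?_)
    exact ENNReal.rpow_ne_top_of_nonneg (by norm_num) (hAfin j)
  refine ⟨M.toReal, ENNReal.toReal_nonneg, fun f hf => ?_⟩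
  rw [ENNReal.ofReal_toReal hMfin]
  calc _ ≤ (∫⁻ _ in ball (0 : EuclideanSpace ℝ (Fin (n + 1))) R,
          (∏ j, volume (A j) ^ (1 / 2 : ℝ) * eLpNorm (f j) 2 volume) ^ ((2 : ℝ) / n))
            ^ ((n : ℝ) / 2) := by
        gcongr with ξ
        rw [← ENNReal.prod_rpow_of_nonneg (by positivity)]
        gcongr with j
        exact enorm_fhat_le (hA j) (hf j) ξ
    _ = _ := by
        rw [setLIntegral_const, ENNReal.mul_rpow_of_nonneg _ _ (by positivity), ← ENNReal.rpow_mul,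
          div_mul_div_cancel₀ hn0.ne', div_self two_ne_zero, ENNReal.rpow_one,
          Finset.prod_mul_distrib, ← hV, hM]
        ring

/-- The uncertainty-principle lemma of Tao–Vargas–Vega type: for transversal smooth
compact parametrised hypersurfaces and all sufficiently large `c`, one has
`C_rest(R) ≤ C' C̃_rest(R)` uniformly in `R ≥ 1`. -/
theorem rest_le_tilde_rest (n : ℕ) (hn : 1 ≤ n) (ν₀ : ℝ) (hν₀ : 0 < ν₀)
    (U : Fin (n + 1) → Set (EuclideanSpace ℝ (Fin n))) (hU : ∀ j, IsCompact (U j))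
    (S : Fin (n + 1) → EuclideanSpace ℝ (Fin n) → EuclideanSpace ℝ (Fin (n + 1)))
    (hS : ∀ j, ContDiff ℝ (⊤ : ℕ∞) (S j))
    (hSimm : ∀ j, ∀ x ∈ U j, Function.Injective (fderiv ℝ (S j) x))
    (ν : Fin (n + 1) → EuclideanSpace ℝ (Fin n) → EuclideanSpace ℝ (Fin (n + 1)))
    (hνunit : ∀ j, ∀ x ∈ U j, ‖ν j x‖ = 1)
    (hνperp : ∀ j, ∀ x ∈ U j, ∀ v, ⟪ν j x, fderiv ℝ (S j) x v⟫_ℝ = 0)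
    (htrans : ∀ x : (j : Fin (n + 1)) → EuclideanSpace ℝ (Fin n),
      (∀ j, x j ∈ U j) →
      ν₀ ≤ |Matrix.det (Matrix.of fun i j => ν j (x j) i)|) :
    ∃ c₀ > 0, ∀ c : ℝ, c₀ ≤ c → ∃ C' > 0, ∀ R : ℝ, 1 ≤ R →
      RestConst n U S R ≤ C' * TildeRestConst n U S c R := by
  have hn0 : (0 : ℝ) < n := by exact_mod_cast hn
  choose K hK0 hK using fun j => exists_enorm_extOp_le_enorm_fhat (hU j) (hS j) (hSimm j)
  refine ⟨1, one_pos, fun c hc => ⟨∏ j, K j + 1, ?_, fun R hR => ?_⟩⟩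
  · have : 0 ≤ ∏ j, K j := Finset.prod_nonneg fun j _ => hK0 j
    positivity
  have hR0 : 0 < R := one_pos.trans_le hR
  have hprod : 0 ≤ ∏ j, K j := Finset.prod_nonneg fun j _ => hK0 j
  rw [mul_comm, ← div_le_iff₀ (by positivity), TildeRestConst]
  refine le_csInf ?_ fun C ⟨hC0, hC⟩ => ?_
  · obtain ⟨C, hC0, hC⟩ := exists_multilinear_fhat_bound
      (fun j => (S j '' U j) + ball 0 (c / R)) (fun j => isOpen_ball.add_left.measurableSet)
      (fun j => (((hU j).image (hS j).continuous).isBounded.add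
        isBounded_ball).measure_lt_top.ne) hn R
    refine ⟨C * R ^ (((n : ℝ) + 1) / 2), by positivity, fun f hf => ?_⟩
    rw [mul_assoc, ← Real.rpow_add hR0, neg_div, add_neg_cancel, Real.rpow_zero, mul_one]
    exact hC f hf
  rw [div_le_iff₀ (by positivity), RestConst]
  refine csInf_le ⟨0, fun _ h => h.1⟩ ⟨by positivity, fun g => ?_⟩
  choose f hfs hfe hfn using fun j => hK j R hR (g j)
  have hsub : ∀ j, Function.support (f j) ⊆ (S j '' U j) + ball 0 (c / R) := fun j =>
    (hfs j).trans (Set.add_subset_add_left (ball_subset_ball (by gcongr)))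
  calc _ ≤ (∫⁻ ξ in ball (0 : EuclideanSpace ℝ (Fin (n + 1))) R,
          ∏ j, (‖fhat (f j) ξ‖₊ : ℝ≥0∞) ^ ((2 : ℝ) / n)) ^ ((n : ℝ) / 2) := by
        gcongr ?_ ^ _
        refine setLIntegral_mono' measurableSet_ball fun ξ hξ => ?_
        gcongr with j
        simpa only [enorm_le_iff_norm_le, ← NNReal.coe_le_coe, coe_nnnorm] using hfe j ξ hξ
    _ ≤ ENNReal.ofReal (C * R ^ (-((n : ℝ) + 1) / 2)) * ∏ j, eLpNorm (f j) 2 volume := hC f hsub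
    _ ≤ ENNReal.ofReal (C * R ^ (-((n : ℝ) + 1) / 2)) *
          ∏ j, (ENNReal.ofReal (K j * R ^ (1 / 2 : ℝ)) *
            eLpNorm (g j) 2 (volume.restrict (U j))) := by
        gcongr with j
        exact hfn j
    _ = ENNReal.ofReal (C * ∏ j, K j) * ∏ j, eLpNorm (g j) 2 (volume.restrict (U j)) := by
        rw [Finset.prod_mul_distrib, ← mul_assoc, ← ENNReal.ofReal_prod_of_nonneg
          fun j _ => mul_nonneg (hK0 j) (by positivity), ← ENNReal.ofReal_mul (by positivity)]
        congr 2
        rw [Finset.prod_mul_distrib, Finset.prod_const, Finset.card_univ, Fintype.card_fin,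
          ← Real.rpow_mul_natCast hR0.le, mul_mul_mul_comm, ← Real.rpow_add hR0]
        have : -((n : ℝ) + 1) / 2 + 1 / 2 * ((n + 1 : ℕ) : ℝ) = 0 := by push_cast; ring
        rw [this, Real.rpow_zero, mul_one]
    _ ≤ _ := by
        gcongr
        linarith
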